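/- arXiv:1011.1773 — 3 statements merged into one kernel-verified Lean document; each statement's English description precedes it below -/
import Mathlib

section
/- Assume 2/3 < φ < φ₂, where φ₂ := 2(1+ρ)(1+ρ²)/(3(1+ρ)(1+ρ²) − (1−ρ)S), and let n ≥ 4 be an even integer. (i) If E_{n,n−2} < 0 and Eₙ ≥ 0, then E_{n,m} < 0 for every integer m with 0 ≤ m ≤ n−1. (ii) If G_{n,n−2} < 0 and H_{n,n−2} ≥ 0, then G_{n,m} < 0 for every 0 ≤ m ≤ n−1 and H_{n,m} < 0 for every 0 ≤ m ≤ n−3. -/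
open Matrix Filter

/-- Game A's one-step transition matrix (fully mixing). -/
noncomputable def PAo : Matrix (Fin 3) (Fin 3) ℝ :=
  !![0, 1/2, 1/2; 1/2, 0, 1/2; 1/2, 1/2, 0]

/-- Game B's one-step transition matrix. -/
noncomputable def PBo (ρ : ℝ) : Matrix (Fin 3) (Fin 3) ℝ :=
  !![0, ρ^2/(1+ρ^2), 1 - ρ^2/(1+ρ^2);
     1 - 1/(1+ρ), 0, 1/(1+ρ);
     1/(1+ρ), 1 - 1/(1+ρ), 0]

/-- Transition matrix when a fraction φ of the players plays game A. -/
noncomputable def PA (φ : ℝ) : Matrix (Fin 3) (Fin 3) ℝ :=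
  (1 - φ) • (1 : Matrix (Fin 3) (Fin 3) ℝ) + φ • PAo

/-- Transition matrix when a fraction φ of the players plays game B. -/
noncomputable def PB (ρ φ : ℝ) : Matrix (Fin 3) (Fin 3) ℝ :=
  (1 - φ) • (1 : Matrix (Fin 3) (Fin 3) ℝ) + φ • PBo ρ

/-- The simplex of probability row vectors in ℝ³. -/
def Δ : Set (Fin 3 → ℝ) := {x | (∀ i, 0 ≤ x i) ∧ x 0 + x 1 + x 2 = 1}

noncomputable def pi0 (ρ : ℝ) : ℝ := (1 + ρ^2) / (2 * (1 + ρ + ρ^2))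
noncomputable def pi1 (ρ : ℝ) : ℝ := ρ * (1 + ρ) / (2 * (1 + ρ + ρ^2))
noncomputable def pi2 (ρ : ℝ) : ℝ := (1 + ρ) / (2 * (1 + ρ + ρ^2))

noncomputable def Sv (ρ : ℝ) : ℝ := Real.sqrt ((1 + ρ^2) * (1 + 4*ρ + ρ^2))

noncomputable def e1 (ρ φ : ℝ) : ℝ :=
  1 - φ + φ * (-(1/2) + (1 - ρ) * Sv ρ / (2 * (1 + ρ) * (1 + ρ^2)))

noncomputable def e2 (ρ φ : ℝ) : ℝ :=
  1 - φ + φ * (-(1/2) - (1 - ρ) * Sv ρ / (2 * (1 + ρ) * (1 + ρ^2)))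

/-- `Emn ρ φ n m` is the quantity `E_{n,m}`; `E_n = Emn ρ φ n n`. -/
noncomputable def Emn (ρ φ : ℝ) (n m : ℕ) : ℝ :=
  φ * (1 - ρ) / 2 *
    ((e2 ρ φ)^m * (2 + (e1 ρ φ)^n * (3*φ - 2)) * (3*(1+ρ)*(1+ρ^2) - (1-ρ) * Sv ρ)
      - (e1 ρ φ)^m * (2 + (e2 ρ φ)^n * (3*φ - 2)) * (3*(1+ρ)*(1+ρ^2) + (1-ρ) * Sv ρ))

/-- `Dn ρ φ n` is the quantity `D_n`. -/
noncomputable def Dn (ρ φ : ℝ) (n : ℕ) : ℝ :=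
  2 * (2 + (e1 ρ φ)^n * (3*φ - 2)) * (2 + (e2 ρ φ)^n * (3*φ - 2)) * (1 + ρ + ρ^2) * Sv ρ

/-- `Gmn ρ φ n m` is the quantity `G_{n,m}`. -/
noncomputable def Gmn (ρ φ : ℝ) (n m : ℕ) : ℝ :=
  φ * (1 - ρ) *
    ((e2 ρ φ)^m * (4 - (e1 ρ φ)^(2*(n-1)) * (3*φ - 2)^2) * (2 - (e2 ρ φ)^(n-2) * (3*φ - 2))
        * (3*(1+ρ)*(1+ρ^2) - (1-ρ) * Sv ρ)
      - (e1 ρ φ)^m * (4 - (e2 ρ φ)^(2*(n-1)) * (3*φ - 2)^2) * (2 - (e1 ρ φ)^(n-2) * (3*φ - 2))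
        * (3*(1+ρ)*(1+ρ^2) + (1-ρ) * Sv ρ))

/-- `Hmn ρ φ n m` is the quantity `H_{n,m}`. -/
noncomputable def Hmn (ρ φ : ℝ) (n m : ℕ) : ℝ :=
  φ * (1 - ρ) *
    ((e2 ρ φ)^m * (4 - (e1 ρ φ)^(2*(n-1)) * (3*φ - 2)^2) * (2 - (e2 ρ φ)^n * (3*φ - 2))
        * (3*(1+ρ)*(1+ρ^2) - (1-ρ) * Sv ρ)
      - (e1 ρ φ)^m * (4 - (e2 ρ φ)^(2*(n-1)) * (3*φ - 2)^2) * (2 - (e1 ρ φ)^n * (3*φ - 2))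
        * (3*(1+ρ)*(1+ρ^2) + (1-ρ) * Sv ρ))

lemma aux_mono (x e A B : ℝ) (hx : 0 < x) (he : e < 0) (hxe : x < -e) (hA : 0 < A) (hB : 0 < B)
    (N : ℕ) (hN : Even N) (h : e^N * A - x^N * B < 0) (m : ℕ) (hm : m ≤ N + 1) :
    e^m * A - x^m * B < 0 := by
  rcases Nat.even_or_odd m with hme | hmo
  · have hmN : m ≤ N := by
      rcases Nat.lt_or_ge N m with h1 | h1
      · exfalso
        have : m = N + 1 := by omega
        subst this
        obtain ⟨a, ha⟩ := hme
        obtain ⟨b, hb⟩ := hN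
        omega
      · exact h1
    obtain ⟨d, rfl⟩ := Nat.exists_eq_add_of_le hmN
    have hde : Even d := (Nat.even_add.mp hN).mp hme
    by_contra hc
    push Not at hc
    have h1 : x^d ≤ e^d := by
      rw [← hde.neg_pow e]
      exact pow_le_pow_left₀ hx.le hxe.le d
    have h2 : 0 ≤ e^m * A := mul_nonneg (hme.pow_nonneg e) hA.le
    have h3 : 0 < x^d := pow_pos hx d
    have h4 : x^d * (x^m * B) ≤ x^d * (e^m * A) := mul_le_mul_of_nonneg_left (by linarith) h3.le
    have h5 : x^d * (e^m * A) ≤ e^d * (e^m * A) := mul_le_mul_of_nonneg_right h1 h2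
    rw [pow_add, pow_add] at h
    nlinarith
  · have h1 : e^m * A < 0 := mul_neg_of_neg_of_pos (hmo.pow_neg he) hA
    have h2 : 0 < x^m * B := mul_pos (pow_pos hx m) hB
    linarith

lemma aux_F (u v : ℝ) (hu : 0 ≤ u) (huv : u ≤ v) (hv : v ≤ 1) (k : ℕ) :
    (1-u)*v^k - (1-v)*u^k ≤ v - u := by
  induction k with
  | zero => simp
  | succ k ih =>
    have h1 : u^k ≤ v^k := pow_le_pow_left₀ hu huv k
    have h2 : 0 ≤ (1-u)*(1-v)*(v^k-u^k) :=
      mul_nonneg (mul_nonneg (by linarith) (by linarith)) (by linarith)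
    rw [pow_succ, pow_succ]
    nlinarith

/-- Passing from `G_{n,n-2} < 0` to `H_{n,n-4} < 0`, with `n = 2j+4`, `u = e₁²`, `v = e₂²`. -/
lemma aux_GH (u v c A B : ℝ) (hu : 0 < u) (huv : u < v) (hv : v < 1) (hc : 0 < c) (hc1 : c < 1)
    (hA : 0 < A) (hB : 0 < B) (j : ℕ)
    (h : v^(j+1) * (2 - v^(j+1)*c) * A - u^(j+1) * (2 - u^(j+1)*c) * B < 0) :
    v^j * (2 - v^(j+2)*c) * A - u^j * (2 - u^(j+2)*c) * B < 0 := by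
  have hv0 : 0 < v := hu.trans huv
  have hF := aux_F u v hu.le huv.le hv.le (j+2)
  have hu1 : u < 1 := huv.trans hv
  have hup : u^(j+1) < 1 := pow_lt_one₀ hu.le hu1 (by omega)
  have hvp : v^(j+1) < 1 := pow_lt_one₀ hv0.le hv (by omega)
  have hup0 : 0 < u^(j+1) := pow_pos hu _
  have hvp0 : 0 < v^(j+1) := pow_pos hv0 _
  have hP : 0 < 2 - u^(j+1)*c := by nlinarith
  have hQ : 0 < 2 - v^(j+1)*c := by nlinarith
  have hP' : 0 < u * (2 - u^(j+1)*c) := mul_pos hu hP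
  have hQ' : 0 < v * (2 - v^(j+1)*c) := mul_pos hv0 hQ
  have hup2 : u^(j+2) < 1 := pow_lt_one₀ hu.le hu1 (by omega)
  have hup20 : 0 < u^(j+2) := pow_pos hu _
  have hR : 0 < 2 - u^(j+2)*c := by nlinarith
  have eu : u^(j+2) = u * u^(j+1) := by ring
  have ev : v^(j+2) = v * v^(j+1) := by ring
  have key : (2 - v^(j+2)*c) * (u * (2 - u^(j+1)*c)) ≤ (2 - u^(j+2)*c) * (v * (2 - v^(j+1)*c)) := by
    have h0 : c * ((1-u)*v^(j+2) - (1-v)*u^(j+2)) ≤ c * (v-u) :=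
      mul_le_mul_of_nonneg_left hF hc.le
    have h1 : c * (v-u) ≤ 2 * (v-u) := by nlinarith
    rw [eu, ev] at h0 ⊢
    nlinarith
  -- multiply through by the positive quantity Q'
  have h' : (v^j * A) * (v * (2 - v^(j+1)*c)) < (u^j * B) * (u * (2 - u^(j+1)*c)) := by
    have a1 : v^(j+1) * (2 - v^(j+1)*c) * A = (v^j * A) * (v * (2 - v^(j+1)*c)) := by ring
    have a2 : u^(j+1) * (2 - u^(j+1)*c) * B = (u^j * B) * (u * (2 - u^(j+1)*c)) := by ring
    linarith
  have hX : 0 < v^j * A := mul_pos (pow_pos hv0 _) hA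
  by_contra hcon
  push Not at hcon
  have hcon' : (u^j * B) * (2 - u^(j+2)*c) ≤ (v^j * A) * (2 - v^(j+2)*c) := by linarith
  have s1 := mul_le_mul_of_nonneg_right hcon' hP'.le
  have s2 := mul_le_mul_of_nonneg_left key hX.le
  have s3 := mul_lt_mul_of_pos_right h' hR
  linarith

lemma aux_E (ρ φ : ℝ) (hρ0 : 0 < ρ) (hρ1 : ρ < 1) (hφ0 : 2/3 < φ)
    (hφ2 : φ < 2*(1+ρ)*(1+ρ^2) / (3*(1+ρ)*(1+ρ^2) - (1-ρ) * Sv ρ)) :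
    φ < 1 ∧ 0 < e1 ρ φ ∧ e2 ρ φ < 0 ∧ e1 ρ φ < - e2 ρ φ ∧ - e2 ρ φ < 1 ∧
    0 < 3*(1+ρ)*(1+ρ^2) - (1-ρ) * Sv ρ ∧ 0 < 3*(1+ρ)*(1+ρ^2) + (1-ρ) * Sv ρ := by
  have hK : 0 < (1+ρ)*(1+ρ^2) := by positivity
  have hSpos : 0 < Sv ρ := Real.sqrt_pos.mpr (by positivity)
  have hS2 : Sv ρ ^ 2 = (1 + ρ^2) * (1 + 4*ρ + ρ^2) := Real.sq_sqrt (by positivity)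
  have hT : 0 < (1-ρ) * Sv ρ := mul_pos (by linarith) hSpos
  have hTK : (1-ρ) * Sv ρ < (1+ρ)*(1+ρ^2) := by
    apply lt_of_pow_lt_pow_left₀ 2 hK.le
    rw [mul_pow, hS2]
    have : 0 < 8 * ρ^2 * (1+ρ^2) := by positivity
    nlinarith
  obtain ⟨t, ht⟩ : ∃ t, t = (1-ρ) * Sv ρ / ((1+ρ)*(1+ρ^2)) := ⟨_, rfl⟩
  have ht0 : 0 < t := ht ▸ div_pos hT hK
  have ht1 : t < 1 := by rw [ht, div_lt_one hK]; exact hTK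
  have hh : (1 - ρ) * Sv ρ / (2 * (1 + ρ) * (1 + ρ^2)) = t / 2 := by
    rw [ht]; field_simp
  have hTt : (1-ρ) * Sv ρ = t * ((1+ρ)*(1+ρ^2)) := by rw [ht]; field_simp
  have hD : 0 < 3*(1+ρ)*(1+ρ^2) - (1-ρ) * Sv ρ := by nlinarith
  rw [lt_div_iff₀ hD, hTt] at hφ2
  have hφt : φ * (3 - t) < 2 := by
    by_contra hc
    push Not at hc
    nlinarith [mul_le_mul_of_nonneg_right hc hK.le]
  have hφ1 : φ < 1 := by nlinarith
  unfold e1 e2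
  rw [hh]
  refine ⟨hφ1, by linarith, by nlinarith, by nlinarith, by nlinarith, hD, by linarith⟩

theorem stmt_17 (ρ φ : ℝ) (hρ0 : 0 < ρ) (hρ1 : ρ < 1) (hφ0 : 2/3 < φ)
    (hφ2 : φ < 2*(1+ρ)*(1+ρ^2) / (3*(1+ρ)*(1+ρ^2) - (1-ρ) * Sv ρ))
    (n : ℕ) (hn : 4 ≤ n) (hne : Even n) :
    (Emn ρ φ n (n - 2) < 0 → 0 ≤ Emn ρ φ n n →
      ∀ m : ℕ, m < n → Emn ρ φ n m < 0) ∧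
    (Gmn ρ φ n (n - 2) < 0 → 0 ≤ Hmn ρ φ n (n - 2) →
      (∀ m : ℕ, m < n → Gmn ρ φ n m < 0) ∧ (∀ m : ℕ, m ≤ n - 3 → Hmn ρ φ n m < 0)) := by
  obtain ⟨hφ1, h1, h2, h12, h21, hD, hD'⟩ := aux_E ρ φ hρ0 hρ1 hφ0 hφ2
  unfold Emn Gmn Hmn
  generalize e1 ρ φ = x at *
  generalize e2 ρ φ = e at *
  generalize 3*(1+ρ)*(1+ρ^2) - (1-ρ) * Sv ρ = D at *
  generalize 3*(1+ρ)*(1+ρ^2) + (1-ρ) * Sv ρ = D' at *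
  have hc0 : 0 < 3*φ - 2 := by linarith
  have hc1 : 3*φ - 2 < 1 := by linarith
  generalize 3*φ - 2 = c at *
  have hpre : 0 < φ * (1 - ρ) := mul_pos (by linarith) (by linarith)
  have hpre2 : 0 < φ * (1 - ρ) / 2 := by positivity
  generalize φ * (1 - ρ) = p at *
  obtain ⟨j, rfl⟩ : ∃ j, n = 2*j+4 := by
    obtain ⟨a, ha⟩ := hne
    exact ⟨a - 2, by omega⟩
  have hn2 : 2*j+4-2 = 2*j+2 := by omega
  have hn3 : 2*j+4-3 = 2*j+1 := by omega
  rw [hn2, hn3]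
  have neg_iff : ∀ q z : ℝ, 0 < q → (q * z < 0 ↔ z < 0) := fun q z hq => by
    constructor
    · intro h
      by_contra hc
      push Not at hc
      exact absurd (mul_nonneg hq.le hc) (not_le.mpr h)
    · exact fun h => mul_neg_of_pos_of_neg hq h
  have ev2 : Even (2*j+2) := ⟨j+1, by omega⟩
  have ev0 : Even (2*j) := ⟨j, by omega⟩
  have hx1 : x < 1 := by linarith
  -- bounds on powers
  have bx : ∀ k : ℕ, 0 < x^k ∧ x^k ≤ 1 := fun k => ⟨pow_pos h1 k, pow_le_one₀ h1.le hx1.le⟩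
  have be : ∀ k : ℕ, Even k → 0 < e^k ∧ e^k ≤ 1 := fun k hk =>
    ⟨hk.pow_pos h2.ne, by
      rw [← hk.neg_pow e]; exact pow_le_one₀ (by linarith) h21.le⟩
  have two_sub : ∀ z : ℝ, 0 < z ∧ z ≤ 1 → 0 < 2 - z * c := fun z hz => by nlinarith [hz.1, hz.2]
  have four_sub : ∀ z : ℝ, 0 < z ∧ z ≤ 1 → 0 < 4 - z * c^2 := fun z hz => by
    have : c^2 < 1 := by nlinarith
    have : 0 < c^2 := by positivity
    nlinarith [hz.1, hz.2]
  have evd : Even (2*(2*j+4-1)) := even_two_mul _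
  have hA4 := four_sub _ (bx (2*(2*j+4-1)))
  have hB4 := four_sub _ (be (2*(2*j+4-1)) evd)
  generalize 4 - x^(2*(2*j+4-1)) * c^2 = A4 at *
  generalize 4 - e^(2*(2*j+4-1)) * c^2 = B4 at *
  refine ⟨fun hE _ m hm => ?_, fun hG _ => ⟨fun m hm => ?_, fun m hm => ?_⟩⟩
  · rw [neg_iff _ _ hpre2] at hE ⊢
    have ev4 : Even (2*j+4) := hne
    have a1 : 0 < (2 + x^(2*j+4) * c) * D :=
      mul_pos (by have := mul_pos (bx (2*j+4)).1 hc0; linarith) hD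
    have a2 : 0 < (2 + e^(2*j+4) * c) * D' :=
      mul_pos (by have := mul_pos (be (2*j+4) ev4).1 hc0; linarith) hD'
    have := aux_mono x e _ _ h1 h2 h12 a1 a2 (2*j+2) ev2 (by linarith) m (by omega)
    linarith
  · rw [neg_iff _ _ hpre] at hG ⊢
    have a1 := mul_pos (mul_pos hA4 (two_sub _ (be (2*j+2) ev2))) hD
    have a2 := mul_pos (mul_pos hB4 (two_sub _ (bx (2*j+2)))) hD'
    have := aux_mono x e _ _ h1 h2 h12 a1 a2 (2*j+2) ev2 (by linarith) m (by omega)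
    linarith
  · rw [neg_iff _ _ hpre] at hG ⊢
    have a1 := mul_pos (mul_pos hA4 (two_sub _ (be (2*j+4) hne))) hD
    have a2 := mul_pos (mul_pos hB4 (two_sub _ (bx (2*j+4)))) hD'
    have pw : ∀ (z : ℝ) (k : ℕ), z^(2*k) = (z^2)^k := fun z k => pow_mul z 2 k
    have g := aux_GH (x^2) (e^2) c (A4*D) (B4*D') (by positivity) (by nlinarith) (by nlinarith)
      hc0 hc1 (mul_pos hA4 hD) (mul_pos hB4 hD') j (by
        rw [← pw, ← pw]
        have q : 2*(j+1) = 2*j+2 := by omega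
        rw [q]
        linarith)
    rw [← pw, ← pw, ← pw, ← pw] at g
    have q : 2*(j+2) = 2*j+4 := by omega
    rw [q] at g
    have := aux_mono x e _ _ h1 h2 h12 a1 a2 (2*j) ev0 (by linarith) m (by omega)
    linarith
end

section
/- Assume 2/3 < φ ≤ 1 and γ₂ ≥ α₂, where α₂ := (3φ−2)[(1+ρ)²(1+ρ²) − 2φ(1+ρ)(2+ρ)(1+ρ²) + φ²(4+5ρ+3ρ²+5ρ³+ρ⁴)]/[2(1+ρ)²(1+ρ²)] and γ₂ := [−(1+ρ)²(1+ρ²)² + φ(1+ρ)(5+ρ)(1+ρ²)(1+ρ+ρ²) − 2φ²(1+ρ²)(5+5ρ−ρ²)(1+ρ+ρ²) + φ³(1+ρ+ρ²)(7+5ρ+3ρ²+5ρ³−2ρ⁴)]/[2(1+ρ)²(1+ρ²)(1+ρ+ρ²)]. Then for every x ∈ Δ with x₀ ≥ π₀: (x·P_A)₀ < π₀, (x·P_A·P_B)₀ < π₀, and (x·P_A·P_B²)₀ ≥ π₀; consequently, for every k ≥ 0, (x·(P_A·P_B²)^k)₀ ≥ π₀ (so the greedy strategy from any state in Δ_A follows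 the pattern ABB forever), and x·(P_A·P_B²)^k converges, as k → ∞, to the unique probability row vector fixed by P_A·P_B². -/
open Matrix Filter

lemma s18_vA (φ : ℝ) (v : Fin 3 → ℝ) : v ᵥ* PA φ =
    ![(1-φ) * v 0 + φ/2 * (v 1 + v 2), (1-φ) * v 1 + φ/2 * (v 0 + v 2),
      (1-φ) * v 2 + φ/2 * (v 0 + v 1)] := by
  ext j
  fin_cases j <;>
    simp [PA, PAo, Matrix.vecMul, dotProduct, Fin.sum_univ_three, Matrix.one_apply] <;> ring

lemma s18_vB (ρ φ : ℝ) (v : Fin 3 → ℝ) : v ᵥ* PB ρ φ =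
    ![(1-φ) * v 0 + φ * ((1 - 1/(1+ρ)) * v 1 + 1/(1+ρ) * v 2),
      (1-φ) * v 1 + φ * (ρ^2/(1+ρ^2) * v 0 + (1 - 1/(1+ρ)) * v 2),
      (1-φ) * v 2 + φ * ((1 - ρ^2/(1+ρ^2)) * v 0 + 1/(1+ρ) * v 1)] := by
  ext j
  fin_cases j <;>
    simp [PB, PBo, Matrix.vecMul, dotProduct, Fin.sum_univ_three, Matrix.one_apply] <;> ring

/-- The l1 norm on row vectors. -/
def s18N (v : Fin 3 → ℝ) : ℝ := |v 0| + |v 1| + |v 2|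

lemma s18_p0 (ρ : ℝ) : 0 ≤ ρ^2/(1+ρ^2) ∧ ρ^2/(1+ρ^2) ≤ 1 := by
  have : 0 < 1 + ρ^2 := by positivity
  refine ⟨by positivity, ?_⟩
  rw [div_le_one this]; linarith

lemma s18_p1 (ρ : ℝ) (h0 : 0 < ρ) : 0 ≤ 1/(1+ρ) ∧ 1/(1+ρ) ≤ 1 := by
  refine ⟨by positivity, ?_⟩
  rw [div_le_one (by positivity)]; linarith

lemma s18_NB (ρ φ : ℝ) (hρ : 0 < ρ) (h0 : 0 ≤ φ) (h1 : φ ≤ 1) (v : Fin 3 → ℝ) :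
    s18N (v ᵥ* PB ρ φ) ≤ s18N v := by
  obtain ⟨a0, a1⟩ := s18_p0 ρ
  obtain ⟨b0, b1⟩ := s18_p1 ρ hρ
  rw [s18_vB]
  simp only [s18N, Matrix.cons_val_zero, Matrix.cons_val_one, Matrix.cons_val]
  generalize ρ^2/(1+ρ^2) = p at *
  generalize 1/(1+ρ) = q at *
  have key : ∀ a b c x y z : ℝ, 0 ≤ a → 0 ≤ b → 0 ≤ c →
      |a * x + φ * (b * y + c * z)| ≤ a * |x| + φ * (b * |y| + c * |z|) := by
    intro a b c x y z ha hb hc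
    refine (abs_add_le _ _).trans ?_
    rw [abs_mul, abs_mul, abs_of_nonneg ha, abs_of_nonneg h0]
    gcongr
    refine (abs_add_le _ _).trans ?_
    rw [abs_mul, abs_mul, abs_of_nonneg hb, abs_of_nonneg hc]
  have k1 := key (1-φ) (1-q) q (v 0) (v 1) (v 2) (by linarith) (by linarith) b0
  have k2 := key (1-φ) p (1-q) (v 1) (v 0) (v 2) (by linarith) a0 (by linarith)
  have k3 := key (1-φ) (1-p) q (v 2) (v 0) (v 1) (by linarith) (by linarith) b0
  linarith

lemma s18_NA (φ : ℝ) (h0 : 2/3 < φ) (h1 : φ ≤ 1) (v : Fin 3 → ℝ)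
    (hv : v 0 + v 1 + v 2 = 0) : s18N (v ᵥ* PA φ) ≤ 1/2 * s18N v := by
  rw [s18_vA]
  simp only [s18N, Matrix.cons_val_zero, Matrix.cons_val_one, Matrix.cons_val]
  have key : ∀ x y z : ℝ, x + y + z = 0 → |(1-φ) * x + φ/2 * (y + z)| ≤ 1/2 * |x| := by
    intro x y z h
    have : (1-φ) * x + φ/2 * (y + z) = (1 - 3*φ/2) * x := by
      have : y + z = -x := by linarith
      rw [this]; ring
    rw [this, abs_mul]
    gcongr
    rw [abs_le]; constructor <;> linarith
  have k1 := key (v 0) (v 1) (v 2) hv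
  have k2 := key (v 1) (v 0) (v 2) (by linarith)
  have k3 := key (v 2) (v 0) (v 1) (by linarith)
  linarith

lemma s18_DA (φ : ℝ) (h0 : 0 ≤ φ) (h1 : φ ≤ 1) (v : Fin 3 → ℝ) (hv : v ∈ Δ) :
    v ᵥ* PA φ ∈ Δ := by
  obtain ⟨hp, hs⟩ := hv
  have x0 := hp 0
  have x1 := hp 1
  have x2 := hp 2
  have : 0 ≤ 1 - φ := by linarith
  rw [s18_vA]
  refine ⟨?_, ?_⟩
  · intro i
    fin_cases i <;> simp only [Fin.zero_eta, Fin.mk_one, Fin.reduceFinMk, Matrix.cons_val_zero,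
      Matrix.cons_val_one, Matrix.cons_val] <;> positivity
  · simp only [Matrix.cons_val_zero, Matrix.cons_val_one, Matrix.cons_val]
    linear_combination hs

lemma s18_DB (ρ φ : ℝ) (hρ : 0 < ρ) (h0 : 0 ≤ φ) (h1 : φ ≤ 1) (v : Fin 3 → ℝ) (hv : v ∈ Δ) :
    v ᵥ* PB ρ φ ∈ Δ := by
  obtain ⟨a0, a1⟩ := s18_p0 ρ
  obtain ⟨b0, b1⟩ := s18_p1 ρ hρ
  obtain ⟨hp, hs⟩ := hv
  have x0 := hp 0
  have x1 := hp 1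
  have x2 := hp 2
  have : 0 ≤ 1 - φ := by linarith
  rw [s18_vB]
  generalize ρ^2/(1+ρ^2) = p at *
  generalize 1/(1+ρ) = q at *
  have : 0 ≤ 1 - p := by linarith
  have : 0 ≤ 1 - q := by linarith
  refine ⟨?_, ?_⟩
  · intro i
    fin_cases i <;> simp only [Fin.zero_eta, Fin.mk_one, Fin.reduceFinMk, Matrix.cons_val_zero,
      Matrix.cons_val_one, Matrix.cons_val] <;> positivity
  · simp only [Matrix.cons_val_zero, Matrix.cons_val_one, Matrix.cons_val]
    linear_combination hs

lemma s18_split (ρ φ : ℝ) (v : Fin 3 → ℝ) :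
    v ᵥ* (PA φ * (PB ρ φ)^2) = ((v ᵥ* PA φ) ᵥ* PB ρ φ) ᵥ* PB ρ φ := by
  rw [pow_two, Matrix.vecMul_vecMul, Matrix.vecMul_vecMul]

lemma s18_fin3 (P : Fin 3 → Prop) (h0 : P 0) (h1 : P 1) (h2 : P 2) : ∀ i, P i := by
  intro i; fin_cases i <;> assumption

/-- Generic convergence lemma: a matrix mapping the simplex to itself, contracting in l1. -/
lemma s18_conv (M : Matrix (Fin 3) (Fin 3) ℝ) (hD : ∀ v ∈ Δ, v ᵥ* M ∈ Δ)
    (hC : ∀ v : Fin 3 → ℝ, v 0 + v 1 + v 2 = 0 → s18N (v ᵥ* M) ≤ 1/2 * s18N v)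
    (x : Fin 3 → ℝ) (hx : x ∈ Δ) :
    ∃ w : Fin 3 → ℝ, w ∈ Δ ∧ w ᵥ* M = w ∧
        (∀ w' : Fin 3 → ℝ, w' ∈ Δ → w' ᵥ* M = w' → w' = w) ∧
        Tendsto (fun k : ℕ => x ᵥ* (M ^ k)) atTop (nhds w) := by
  have hstep : ∀ k : ℕ, x ᵥ* (M ^ (k+1)) = (x ᵥ* (M ^ k)) ᵥ* M := by
    intro k; rw [pow_succ, Matrix.vecMul_vecMul]
  have hmem : ∀ k : ℕ, x ᵥ* (M ^ k) ∈ Δ := by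
    intro k
    induction k with
    | zero => simpa using hx
    | succ k ih => rw [hstep]; exact hD _ ih
  have hN : ∀ v : Fin 3 → ℝ, ‖v‖ ≤ s18N v := by
    intro v
    have := abs_nonneg (v 0)
    have := abs_nonneg (v 1)
    have := abs_nonneg (v 2)
    refine (pi_norm_le_iff_of_nonneg (by unfold s18N; linarith)).2 ?_
    apply s18_fin3 <;> simp only [Real.norm_eq_abs, s18N] <;> linarith
  have hdiff : ∀ k : ℕ, s18N (x ᵥ* (M ^ k) - x ᵥ* (M ^ (k+1))) ≤
      s18N (x - x ᵥ* M) * (1/2)^k := by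
    intro k
    induction k with
    | zero => simp
    | succ k ih =>
      rw [hstep (k+1)]
      nth_rewrite 1 [hstep k]
      rw [← Matrix.sub_vecMul]
      refine (hC _ ?_).trans ?_
      · have h1 := (hmem k).2
        have h2 := (hmem (k+1)).2
        simp only [Pi.sub_apply]; linarith
      · rw [pow_succ (1/2 : ℝ)]; linarith
  have hcau : CauchySeq (fun k : ℕ => x ᵥ* (M ^ k)) := by
    refine cauchySeq_of_le_geometric (1/2) (s18N (x - x ᵥ* M)) (by norm_num) ?_
    intro k
    rw [dist_eq_norm]
    exact (hN _).trans (hdiff k)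
  obtain ⟨w, hw⟩ := cauchySeq_tendsto_of_complete hcau
  have hcl : IsClosed Δ := by
    have : Δ = {x : Fin 3 → ℝ | ∀ i, 0 ≤ x i} ∩ {x | x 0 + x 1 + x 2 = 1} := rfl
    rw [this]
    refine IsClosed.inter ?_ ?_
    · simp only [Set.ofPred_forall]
      exact isClosed_iInter fun i => isClosed_le continuous_const (continuous_apply i)
    · exact isClosed_eq (by fun_prop) continuous_const
  have hwD : w ∈ Δ := hcl.mem_of_tendsto hw (Filter.Eventually.of_forall hmem)
  have hfix : w ᵥ* M = w := by
    have hc : Continuous fun v : Fin 3 → ℝ => v ᵥ* M := by fun_prop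
    have t1 := (hc.tendsto w).comp hw
    have t2 := (tendsto_add_atTop_iff_nat 1).2 hw
    refine tendsto_nhds_unique t1 (t2.congr ?_)
    intro k; exact hstep k
  refine ⟨w, hwD, hfix, ?_, hw⟩
  intro w' hw' hf'
  have h := hC (w' - w) (by
    have := hw'.2
    have := hwD.2
    simp only [Pi.sub_apply]; linarith)
  rw [Matrix.sub_vecMul, hfix, hf'] at h
  have h2 := hN (w' - w)
  have h3 : ‖w' - w‖ ≤ 0 := by linarith
  exact sub_eq_zero.1 (norm_le_zero_iff.1 h3)

/-- The core polynomial inequality, in the variables h = (1-ρ)^2/(1+ρ^2), t = φ - 2/3. -/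
lemma s18_core (h t : ℝ) (h0 : 0 < h) (h1 : h < 1) (t0 : 0 < t)
    (hm : 0 ≤ 3/2 * (3-h) * t^2 - h/3) :
    0 < 3*t*(2-h)*(3/2 * (3-h) * t^2 - h/3)
      - ((3-h)^2*t^2/2 - h/9*(3-2*h)*(1+3*t)) * (h/3 + (3-h)*t) := by
  have hA : h < 3*t*(3-2*h) := by
    have hpos : 0 < 3*t*(3-2*h) := by
      have : 0 < 3 - 2*h := by linarith
      positivity
    refine lt_of_pow_lt_pow_left₀ 2 hpos.le ?_
    have e1 : 0 ≤ (9/2 * (3-h) * t^2 - h) * (2*(3-2*h)^2) := by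
      apply mul_nonneg <;> nlinarith [sq_nonneg (3-2*h)]
    have e2 : 0 < h * (9*(1-h)*(2-h)) := by
      have : 0 < 1 - h := by linarith
      have : 0 < 2 - h := by linarith
      positivity
    have e3 : 0 < (3-h) * ((3*t*(3-2*h))^2 - h^2) := by nlinarith
    have := (mul_pos_iff_of_pos_left (show 0 < 3 - h by linarith)).1 e3
    linarith
  set m := 3/2 * (3-h) * t^2 - h/3 with hmdef
  have hB : 0 ≤ t*(9-3*h-h^2)/3 - h*(3-h)/9 := by
    have a : 0 ≤ (3*t*(3-2*h) - h) * (9-3*h-h^2) := by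
      apply mul_nonneg <;> nlinarith
    have b : 0 ≤ h * (6*h - 3*h^2) := by apply mul_nonneg <;> nlinarith
    have c : 0 ≤ (3-2*h) * (t*(9-3*h-h^2)/3 - h*(3-h)/9) := by nlinarith
    exact nonneg_of_mul_nonneg_right c (by linarith)
  have hn : 0 < h/3 + (3-h)*t := by
    have : 0 < 3 - h := by linarith
    positivity
  have e : 3*t*(2-h)*m - ((3-h)^2*t^2/2 - h/9*(3-2*h)*(1+3*t)) * (h/3 + (3-h)*t)
      = m * (t*(9-3*h-h^2)/3 - h*(3-h)/9) + (h/3 + (3-h)*t) * (h/9) * (3*t*(3-2*h) - h) := by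
    rw [hmdef]; ring
  rw [e]
  have : 0 < (h/3 + (3-h)*t) * (h/9) * (3*t*(3-2*h) - h) := by
    have : 0 < 3*t*(3-2*h) - h := by linarith
    positivity
  have := mul_nonneg hm hB
  linarith

/-- The quantity γ₂ - α₂. -/
noncomputable def s18G (ρ φ : ℝ) : ℝ :=
        (-(1+ρ)^2*(1+ρ^2)^2 + φ*(1+ρ)*(5+ρ)*(1+ρ^2)*(1+ρ+ρ^2)
          - 2*φ^2*(1+ρ^2)*(5 + 5*ρ - ρ^2)*(1+ρ+ρ^2)
          + φ^3*(1+ρ+ρ^2)*(7 + 5*ρ + 3*ρ^2 + 5*ρ^3 - 2*ρ^4))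
          / (2*(1+ρ)^2*(1+ρ^2)*(1+ρ+ρ^2)) -
      (3*φ - 2) * ((1+ρ)^2*(1+ρ^2) - 2*φ*(1+ρ)*(2+ρ)*(1+ρ^2)
          + φ^2*(4 + 5*ρ + 3*ρ^2 + 5*ρ^3 + ρ^4)) / (2*(1+ρ)^2*(1+ρ^2))

lemma s18_d1e0 (ρ φ : ℝ) (hρ0 : 0 < ρ) (hρ1 : ρ < 1) (hφ0 : 2/3 < φ)
    (hG : 0 ≤ s18G ρ φ) : (1-φ)^2 + φ^2/2 < pi0 ρ := by
  by_contra! hcon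
  have q1 : 0 < 1 + ρ^2 := by positivity
  have q2 : 0 < 1 + ρ + ρ^2 := by positivity
  have q3 : 0 < 1 + ρ := by positivity
  set h := (1-ρ)^2/(1+ρ^2) with hh
  set t := φ - 2/3 with ht
  have h0 : 0 < h := div_pos (pow_pos (by linarith) 2) q1
  have h1 : h < 1 := by rw [hh, div_lt_one q1]; nlinarith
  have em : 3/2 * (3-h) * t^2 - h/3 = (3-h) * ((1-φ)^2 + φ^2/2 - pi0 ρ) := by
    rw [hh, ht, pi0]; field_simp; ring
  have hc := s18_core h t h0 h1 (by linarith) (by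
    rw [em]; apply mul_nonneg <;> linarith)
  have e2 : 3*t*(2-h)*(3/2 * (3-h) * t^2 - h/3)
      - ((3-h)^2*t^2/2 - h/9*(3-2*h)*(1+3*t)) * (h/3 + (3-h)*t)
      = -((2-h)*(3-h) * s18G ρ φ) := by
    rw [hh, ht, s18G]; field_simp; ring
  rw [e2] at hc
  have : 0 ≤ (2-h)*(3-h) * s18G ρ φ := by
    apply mul_nonneg _ hG
    apply mul_nonneg <;> linarith
  linarith

lemma s18_third (ρ : ℝ) (hρ0 : 0 < ρ) (hρ1 : ρ < 1) : 1/3 < pi0 ρ := by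
  rw [pi0, div_lt_div_iff₀ (by norm_num) (by positivity)]
  nlinarith [pow_pos (sub_pos.2 hρ1) 2]

lemma s18_pi1 (ρ : ℝ) (hρ0 : 0 < ρ) : pi0 ρ < 1 := by
  rw [pi0, div_lt_one (by positivity)]
  nlinarith

lemma s18_d0 (ρ φ : ℝ) (hρ0 : 0 < ρ) (hρ1 : ρ < 1) (hφ0 : 2/3 < φ)
    (x : Fin 3 → ℝ) (hx : x ∈ Δ) (hx0 : pi0 ρ ≤ x 0) : (x ᵥ* PA φ) 0 < pi0 ρ := by
  have h3 := s18_third ρ hρ0 hρ1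
  rw [s18_vA]
  simp only [Matrix.cons_val_zero]
  have : x 1 + x 2 = 1 - x 0 := by have := hx.2; linarith
  rw [this]
  nlinarith

lemma s18_v1 (ρ φ : ℝ) (hρ0 : 0 < ρ) (hρ1 : ρ < 1) (hφ0 : 2/3 < φ)
    (hc : 0 < 1 - φ - φ * (ρ/(1+ρ))) :
    (1-φ)^2 + φ^2/2 + (3*φ/2-1) * ((1 - pi0 ρ) * (1 - φ - φ * (ρ/(1+ρ)))) < pi0 ρ := by
  have q2 : 0 < 1 + ρ + ρ^2 := by positivity
  have q3 : 0 < 1 + ρ := by positivity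
  have q4 : 0 < 1 + 2*ρ := by positivity
  have h3 := s18_third ρ hρ0 hρ1
  have hu : φ < (1+ρ)/(1+2*ρ) := by
    rw [lt_div_iff₀ q4]
    have : 1 - φ - φ * (ρ/(1+ρ)) = (1 + ρ - φ*(1+2*ρ))/(1+ρ) := by field_simp; ring
    rw [this] at hc
    have := (div_pos_iff_of_pos_right q3).1 hc
    linarith
  have hP := s18_pi1 ρ hρ0
  have hq : ρ/(1+ρ) < 1/2 := by rw [div_lt_div_iff₀ q3 (by norm_num)]; linarith
  have hq0 : 0 < ρ/(1+ρ) := by positivity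
  -- the left side minus pi0 is a convex quadratic in φ, negative at both ends
  have h2u : 2/3 < (1+ρ)/(1+2*ρ) := by linarith
  have hend : (1-(1+ρ)/(1+2*ρ))^2 + ((1+ρ)/(1+2*ρ))^2/2 < pi0 ρ := by
    have : pi0 ρ - ((1-(1+ρ)/(1+2*ρ))^2 + ((1+ρ)/(1+2*ρ))^2/2)
        = ρ*(1-ρ)^2*(1+ρ)/(2*(1+2*ρ)^2*(1+ρ+ρ^2)) := by
      rw [pi0]; field_simp; ring
    have h : 0 < ρ*(1-ρ)^2*(1+ρ)/(2*(1+2*ρ)^2*(1+ρ+ρ^2)) := by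
      have : 0 < 1 - ρ := by linarith
      positivity
    linarith
  have hz : 1 - (1+ρ)/(1+2*ρ) - (1+ρ)/(1+2*ρ) * (ρ/(1+ρ)) = 0 := by field_simp; ring
  generalize (1+ρ)/(1+2*ρ) = u at *
  generalize ρ/(1+ρ) = q at *
  generalize pi0 ρ = P at *
  -- convexity
  have hA : 0 < 3/2*(P - q*(1-P)) := by nlinarith
  have hid : (u - 2/3) * ((1-φ)^2 + φ^2/2 + (3*φ/2-1) * ((1 - P) * (1 - φ - φ * q)) - P)
      = (φ - 2/3) * ((1-u)^2 + u^2/2 + (3*u/2-1) * ((1 - P) * (1 - u - u * q)) - P)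
        + (u - φ) * (1/3 - P)
        - (u - 2/3) * (3/2*(P - q*(1-P))) * ((φ - 2/3) * (u - φ)) := by ring
  rw [hz] at hid
  have k1 : 0 < (φ - 2/3) * (P - ((1-u)^2 + u^2/2)) := mul_pos (by linarith) (by linarith)
  have k2 : 0 < (u - φ) * (P - 1/3) := mul_pos (by linarith) (by linarith)
  have k3 : 0 < (u - 2/3) * (3/2*(P - q*(1-P))) * ((φ - 2/3) * (u - φ)) :=
    mul_pos (mul_pos (by linarith) hA) (mul_pos (by linarith) (by linarith))
  have k4 : (u - 2/3) * ((1-φ)^2 + φ^2/2 + (3*φ/2-1) * ((1 - P) * (1 - φ - φ * q)) - P) < 0 := by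
    rw [hid]; nlinarith
  have := neg_of_mul_neg_right k4 (by linarith)
  linarith

lemma s18_d1 (ρ φ : ℝ) (hρ0 : 0 < ρ) (hρ1 : ρ < 1) (hφ0 : 2/3 < φ) (hφ1 : φ ≤ 1)
    (hG : 0 ≤ s18G ρ φ) (x : Fin 3 → ℝ) (hx : x ∈ Δ) (hx0 : pi0 ρ ≤ x 0) :
    ((x ᵥ* PA φ) ᵥ* PB ρ φ) 0 < pi0 ρ := by
  have h3 := s18_third ρ hρ0 hρ1
  have hp1 := s18_pi1 ρ hρ0
  have hd := s18_d1e0 ρ φ hρ0 hρ1 hφ0 hG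
  have x1 := hx.1 1
  have x2 := hx.1 2
  have e0 : x 0 = 1 - x 1 - x 2 := by have := hx.2; linarith
  have q3 : 0 < 1 + ρ := by positivity
  have e : ((x ᵥ* PA φ) ᵥ* PB ρ φ) 0 = (1-φ)^2 + φ^2/2 +
      (3*φ/2-1) * (x 1 * (1 - φ - φ * (ρ/(1+ρ))) + x 2 * (1 - φ - φ * (1/(1+ρ)))) := by
    rw [s18_vA, s18_vB]
    simp only [Matrix.cons_val_zero, Matrix.cons_val_one, Matrix.cons_val]
    rw [e0]; field_simp; ring
  have hhalf : 1/2 < 1/(1+ρ) := by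
    rw [div_lt_div_iff₀ (by norm_num) q3]; linarith
  have hc2 : x 2 * (1 - φ - φ * (1/(1+ρ))) ≤ 0 := by
    apply mul_nonpos_of_nonneg_of_nonpos x2
    nlinarith
  have ht : 0 < 3*φ/2-1 := by linarith
  rw [e]
  rcases le_or_gt (1 - φ - φ * (ρ/(1+ρ))) 0 with hc1 | hc1
  · have := mul_nonpos_of_nonneg_of_nonpos x1 hc1
    have := mul_nonpos_of_nonneg_of_nonpos ht.le (add_nonpos this hc2)
    linarith
  · have a : x 1 * (1 - φ - φ * (ρ/(1+ρ))) ≤ (1 - pi0 ρ) * (1 - φ - φ * (ρ/(1+ρ))) := by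
      apply mul_le_mul_of_nonneg_right _ hc1.le
      linarith
    have b := mul_le_mul_of_nonneg_left (add_le_add a hc2) ht.le
    have c := s18_v1 ρ φ hρ0 hρ1 hφ0 hc1
    linarith

lemma s18_d2 (ρ φ : ℝ) (hρ0 : 0 < ρ) (hρ1 : ρ < 1) (hφ0 : 2/3 < φ) (hφ1 : φ ≤ 1)
    (hG : 0 ≤ s18G ρ φ) (x : Fin 3 → ℝ) (hx : x ∈ Δ) :
    pi0 ρ ≤ (((x ᵥ* PA φ) ᵥ* PB ρ φ) ᵥ* PB ρ φ) 0 := by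
  have x1 := hx.1 1
  have x2 := hx.1 2
  have e0 : x 0 = 1 - x 1 - x 2 := by have := hx.2; linarith
  have q1 : 0 < 1 + ρ^2 := by positivity
  have q2 : 0 < 1 + ρ + ρ^2 := by positivity
  have q3 : 0 < 1 + ρ := by positivity
  have e : (((x ᵥ* PA φ) ᵥ* PB ρ φ) ᵥ* PB ρ φ) 0 = pi0 ρ + s18G ρ φ +
      (3*φ/2-1) * (x 1 * ((1 - φ - φ * (ρ/(1+ρ)))^2 + φ^2*ρ*(1-ρ)^2/((1+ρ)^2*(1+ρ^2)))
        + x 2 * ((1 - φ - φ * (1/(1+ρ)))^2 + φ^2*ρ*(1-ρ)^2/((1+ρ)^2*(1+ρ^2)))) := by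
    rw [s18_vA, s18_vB, s18_vB]
    simp only [Matrix.cons_val_zero, Matrix.cons_val_one, Matrix.cons_val]
    rw [e0, pi0, s18G]; field_simp; ring
  have ht : 0 ≤ 3*φ/2-1 := by linarith
  rw [e]
  have : 0 ≤ (3*φ/2-1) *
      (x 1 * ((1 - φ - φ * (ρ/(1+ρ)))^2 + φ^2*ρ*(1-ρ)^2/((1+ρ)^2*(1+ρ^2)))
        + x 2 * ((1 - φ - φ * (1/(1+ρ)))^2 + φ^2*ρ*(1-ρ)^2/((1+ρ)^2*(1+ρ^2)))) := by
    positivity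
  linarith

theorem stmt_18 (ρ φ : ℝ) (hρ0 : 0 < ρ) (hρ1 : ρ < 1) (hφ0 : 2/3 < φ) (hφ1 : φ ≤ 1)
    (hregion3 :
      (3*φ - 2) * ((1+ρ)^2*(1+ρ^2) - 2*φ*(1+ρ)*(2+ρ)*(1+ρ^2)
          + φ^2*(4 + 5*ρ + 3*ρ^2 + 5*ρ^3 + ρ^4)) / (2*(1+ρ)^2*(1+ρ^2)) ≤
        (-(1+ρ)^2*(1+ρ^2)^2 + φ*(1+ρ)*(5+ρ)*(1+ρ^2)*(1+ρ+ρ^2)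
          - 2*φ^2*(1+ρ^2)*(5 + 5*ρ - ρ^2)*(1+ρ+ρ^2)
          + φ^3*(1+ρ+ρ^2)*(7 + 5*ρ + 3*ρ^2 + 5*ρ^3 - 2*ρ^4))
          / (2*(1+ρ)^2*(1+ρ^2)*(1+ρ+ρ^2))) :
    ∀ x : Fin 3 → ℝ, x ∈ Δ → pi0 ρ ≤ x 0 →
      (x ᵥ* PA φ) 0 < pi0 ρ ∧
      ((x ᵥ* PA φ) ᵥ* PB ρ φ) 0 < pi0 ρ ∧
      pi0 ρ ≤ (x ᵥ* (PA φ * (PB ρ φ) ^ 2)) 0 ∧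
      (∀ k : ℕ, pi0 ρ ≤ (x ᵥ* ((PA φ * (PB ρ φ) ^ 2) ^ k)) 0) ∧
      ∃ w : Fin 3 → ℝ, w ∈ Δ ∧ w ᵥ* (PA φ * (PB ρ φ) ^ 2) = w ∧
        (∀ w' : Fin 3 → ℝ, w' ∈ Δ → w' ᵥ* (PA φ * (PB ρ φ) ^ 2) = w' → w' = w) ∧
        Tendsto (fun k : ℕ => x ᵥ* ((PA φ * (PB ρ φ) ^ 2) ^ k)) atTop (nhds w) := by
  intro x hx hx0
  have hφ : 0 ≤ φ := by linarith
  have hG : 0 ≤ s18G ρ φ := by unfold s18G; exact sub_nonneg.2 hregion3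
  have hD : ∀ v ∈ Δ, v ᵥ* (PA φ * (PB ρ φ) ^ 2) ∈ Δ := by
    intro v hv
    rw [s18_split]
    exact s18_DB ρ φ hρ0 hφ hφ1 _ (s18_DB ρ φ hρ0 hφ hφ1 _ (s18_DA φ hφ hφ1 v hv))
  have hC : ∀ v : Fin 3 → ℝ, v 0 + v 1 + v 2 = 0 →
      s18N (v ᵥ* (PA φ * (PB ρ φ) ^ 2)) ≤ 1/2 * s18N v := by
    intro v hv
    rw [s18_split]
    exact (s18_NB ρ φ hρ0 hφ hφ1 _).trans
      ((s18_NB ρ φ hρ0 hφ hφ1 _).trans (s18_NA φ hφ0 hφ1 v hv))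
  have hd2 : ∀ v ∈ Δ, pi0 ρ ≤ (v ᵥ* (PA φ * (PB ρ φ) ^ 2)) 0 := by
    intro v hv
    rw [s18_split]
    exact s18_d2 ρ φ hρ0 hρ1 hφ0 hφ1 hG v hv
  refine ⟨s18_d0 ρ φ hρ0 hρ1 hφ0 x hx hx0, s18_d1 ρ φ hρ0 hρ1 hφ0 hφ1 hG x hx hx0,
    hd2 x hx, ?_, s18_conv _ hD hC x hx⟩
  have hstep : ∀ k : ℕ, x ᵥ* ((PA φ * (PB ρ φ) ^ 2) ^ k) ∈ Δ ∧
      pi0 ρ ≤ (x ᵥ* ((PA φ * (PB ρ φ) ^ 2) ^ k)) 0 := by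
    intro k
    induction k with
    | zero => simpa using ⟨hx, hx0⟩
    | succ k ih =>
      rw [pow_succ, ← Matrix.vecMul_vecMul]
      exact ⟨hD _ ih.1, hd2 _ ih.1⟩
  exact fun k => (hstep k).2
end

section
/- Let ζ := (2p₀−1, 2p₁−1, 2p₁−1) and let v·ζ denote the dot product of a row vector v with ζ. Then: (i) π·ζ = 0, where π := (π₀, π₁, π₂) with π₂ := (1+ρ)/(2(1+ρ+ρ²)) (so the asymptotic cumulative average profit per game is 0 when game B is eventually played forever). (ii) If 2/3 < φ ≤ 1, n ≥ 2 is an integer, and v ∈ Δ satisfies v·(P_A·P_B^n) = v, v₀ ≥ π₀, and (v·P_A·P_B^m)₀ < π₀ for every 0 ≤ m ≤ n−1, then the asymptotic cumulative average profit per game for the pattern [1,n], namely μ := (φ/(n+1))·Σ_{m=0}^{n−1} (v·P_A·P_B^m)·ζ, satisfies μ > 0. (iii) If 2/3 < φ ≤ 1, n ≥ 4 is even, and v ∈ Δ satisfies v·(P_A·P_B^n·P_A·P_B^(n−2)) = v, v₀ ≥ π₀, (v·P_A·P_B^m)₀ < π₀ for 0 ≤ m ≤ n−1, (v·P_A·P_B^n)₀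 ≥ π₀, and (v·P_A·P_B^n·P_A·P_B^m)₀ < π₀ for 0 ≤ m ≤ n−3, then μ' := (φ/(2n))·[Σ_{m=0}^{n−1} (v·P_A·P_B^m)·ζ + Σ_{m=0}^{n−3} (v·P_A·P_B^n·P_A·P_B^m)·ζ] satisfies μ' > 0. -/
open Matrix Filter

lemma aux_PA (φ : ℝ) (x : Fin 3 → ℝ) (h : x 0 + x 1 + x 2 = 1) :
    (x ᵥ* PA φ) 0 + (x ᵥ* PA φ) 1 + (x ᵥ* PA φ) 2 = 1 := by
  simp [PA, PAo, vecMul, dotProduct, Fin.sum_univ_three, Matrix.one_apply]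
  linear_combination h

lemma aux_PB (ρ φ : ℝ) (x : Fin 3 → ℝ) (h : x 0 + x 1 + x 2 = 1) :
    (x ᵥ* PB ρ φ) 0 + (x ᵥ* PB ρ φ) 1 + (x ᵥ* PB ρ φ) 2 = 1 := by
  simp [PB, PBo, vecMul, dotProduct, Fin.sum_univ_three, Matrix.one_apply]
  linear_combination h

lemma aux_PBpow (ρ φ : ℝ) (m : ℕ) (x : Fin 3 → ℝ) (h : x 0 + x 1 + x 2 = 1) :
    (x ᵥ* PB ρ φ ^ m) 0 + (x ᵥ* PB ρ φ ^ m) 1 + (x ᵥ* PB ρ φ ^ m) 2 = 1 := by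
  induction m with
  | zero => simpa using h
  | succ k ih =>
    rw [pow_succ, ← vecMul_vecMul]
    exact aux_PB _ _ _ ih

lemma aux_pos (ρ : ℝ) (hρ0 : 0 < ρ) (hρ1 : ρ < 1) (x : Fin 3 → ℝ) (h : x 0 + x 1 + x 2 = 1)
    (hx : x 0 < pi0 ρ) :
    0 < x ⬝ᵥ ![2 * (ρ^2/(1+ρ^2)) - 1, 2 * (1/(1+ρ)) - 1, 2 * (1/(1+ρ)) - 1] := by
  have key : x ⬝ᵥ ![2 * (ρ^2/(1+ρ^2)) - 1, 2 * (1/(1+ρ)) - 1, 2 * (1/(1+ρ)) - 1]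
      = (pi0 ρ - x 0) * (2 * (1 - ρ) * (1 + ρ + ρ^2) / ((1 + ρ) * (1 + ρ^2))) := by
    have h2 : x 2 = 1 - x 0 - x 1 := by linarith
    have : 1 + ρ ≠ 0 := by positivity
    have : 1 + ρ^2 ≠ 0 := by positivity
    have : 1 + ρ + ρ^2 ≠ 0 := by positivity
    simp only [dotProduct, Fin.sum_univ_three, pi0]
    simp [h2]
    field_simp
    ring
  rw [key]
  have : 0 < 1 - ρ := by linarith
  exact mul_pos (by linarith) (by positivity)

theorem stmt_19 (ρ φ : ℝ) (hρ0 : 0 < ρ) (hρ1 : ρ < 1) (hφ0 : 0 < φ) (hφ1 : φ ≤ 1) :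
    let ζ : Fin 3 → ℝ :=
      ![2 * (ρ^2/(1+ρ^2)) - 1, 2 * (1/(1+ρ)) - 1, 2 * (1/(1+ρ)) - 1]
    (![pi0 ρ, pi1 ρ, pi2 ρ] ⬝ᵥ ζ = 0) ∧
    (∀ n : ℕ, 2 ≤ n → 2/3 < φ → ∀ v : Fin 3 → ℝ, v ∈ Δ →
      v ᵥ* (PA φ * (PB ρ φ) ^ n) = v → pi0 ρ ≤ v 0 →
      (∀ m : ℕ, m < n → ((v ᵥ* PA φ) ᵥ* ((PB ρ φ) ^ m)) 0 < pi0 ρ) →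
      0 < φ / (n + 1) * ∑ m ∈ Finset.range n, ((v ᵥ* PA φ) ᵥ* ((PB ρ φ) ^ m)) ⬝ᵥ ζ) ∧
    (∀ n : ℕ, 4 ≤ n → Even n → 2/3 < φ → ∀ v : Fin 3 → ℝ, v ∈ Δ →
      v ᵥ* (PA φ * (PB ρ φ) ^ n * PA φ * (PB ρ φ) ^ (n - 2)) = v → pi0 ρ ≤ v 0 →
      (∀ m : ℕ, m < n → ((v ᵥ* PA φ) ᵥ* ((PB ρ φ) ^ m)) 0 < pi0 ρ) →
      pi0 ρ ≤ ((v ᵥ* PA φ) ᵥ* ((PB ρ φ) ^ n)) 0 →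
      (∀ m : ℕ, m ≤ n - 3 →
        ((((v ᵥ* PA φ) ᵥ* ((PB ρ φ) ^ n)) ᵥ* PA φ) ᵥ* ((PB ρ φ) ^ m)) 0 < pi0 ρ) →
      0 < φ / (2 * n) *
        ((∑ m ∈ Finset.range n, ((v ᵥ* PA φ) ᵥ* ((PB ρ φ) ^ m)) ⬝ᵥ ζ) +
          ∑ m ∈ Finset.range (n - 2),
            ((((v ᵥ* PA φ) ᵥ* ((PB ρ φ) ^ n)) ᵥ* PA φ) ᵥ* ((PB ρ φ) ^ m)) ⬝ᵥ ζ)) := by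
  intro ζ
  refine ⟨?_, ?_, ?_⟩
  · have : 1 + ρ ≠ 0 := by positivity
    have : 1 + ρ^2 ≠ 0 := by positivity
    have : 1 + ρ + ρ^2 ≠ 0 := by positivity
    simp [ζ, dotProduct, Fin.sum_univ_three, pi0, pi1, pi2]
    field_simp
    ring
  · intro n hn _ v hv _ _ hm
    refine mul_pos (by positivity) (Finset.sum_pos (fun m hmn => ?_) ⟨0, by simp; omega⟩)
    exact aux_pos ρ hρ0 hρ1 _ (aux_PBpow _ _ _ _ (aux_PA _ _ hv.2)) (hm m (by simpa using hmn))
  · intro n hn _ _ v hv _ _ hm _ hm'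
    have hn' : (0 : ℝ) < n := by exact_mod_cast (by omega : 0 < n)
    refine mul_pos (by positivity) (add_pos
      (Finset.sum_pos (fun m hmn => ?_) ⟨0, by simp; omega⟩)
      (Finset.sum_pos (fun m hmn => ?_) ⟨0, by simp; omega⟩))
    · exact aux_pos ρ hρ0 hρ1 _ (aux_PBpow _ _ _ _ (aux_PA _ _ hv.2)) (hm m (by simpa using hmn))
    · have hmn2 : m < n - 2 := by simpa using hmn
      exact aux_pos ρ hρ0 hρ1 _ (aux_PBpow _ _ _ _ (aux_PA _ _
        (aux_PBpow _ _ _ _ (aux_PA _ _ hv.2)))) (hm' m (by omega))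
end
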